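/- For every graph G on n vertices, the failed zero forcing number satisfies F(G) ≥ ⌊(n-1)/2⌋. -/

import Mathlib

open SimpleGraph

variable {V : Type*}

/-- Closure of the filled set `S` under the zero forcing color change rule:
a filled vertex with exactly one unfilled neighbor fills that neighbor. -/
inductive ZFDerived (G : SimpleGraph V) (S : Set V) : V → Prop
  | init {v : V} : v ∈ S → ZFDerived G S v
  | force {v w : V} : ZFDerived G S v → G.Adj v w →
      (∀ u, G.Adj v u → u ≠ w → ZFDerived G S u) → ZFDerived G S w

/-- The derived set of `S`. -/
def ZFDerivedSet (G : SimpleGraph V) (S : Set V) : Set V := {v | ZFDerived G S v}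

/-- `S` is a zero forcing set if its derived set is all of `V`. -/
def IsZeroForcing (G : SimpleGraph V) (S : Set V) : Prop :=
  ZFDerivedSet G S = Set.univ

/-- `S` is a failed zero forcing set if its derived set is not all of `V`. -/
def IsFailed (G : SimpleGraph V) (S : Set V) : Prop :=
  ZFDerivedSet G S ≠ Set.univ

/-- The failed zero forcing number `F(G)`: the maximum size of a failed zero forcing set. -/
noncomputable def failedZF (G : SimpleGraph V) : ℕ :=
  sSup {k | ∃ S : Finset V, IsFailed G ↑S ∧ S.card = k}

/-- The zero forcing number `Z(G)`: the minimum size of a zero forcing set. -/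
noncomputable def zfNum (G : SimpleGraph V) : ℕ :=
  sInf {k | ∃ S : Finset V, IsZeroForcing G ↑S ∧ S.card = k}

/-- The number of edges, with multiplicities `m`, from `v` to the vertices of `A` whose colour under
`s` differs from that of `v`. -/
def crossCount (m : V → V → ℕ) (A : Finset V) (s : V → Bool) (v : V) : ℕ :=
  ∑ u ∈ A, if s u = s v then 0 else m v u

lemma crossCount_congr {m m' : V → V → ℕ} {A : Finset V} {s s' : V → Bool} {v : V} (hv : v ∈ A)
    (hm : ∀ u ∈ A, m v u = m' v u) (hs : ∀ u ∈ A, s u = s' u) :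
    crossCount m A s v = crossCount m' A s' v := by
  refine Finset.sum_congr rfl fun u hu => ?_
  rw [hm u hu, hs u hu, hs v hv]

lemma crossCount_eq_add_erase [DecidableEq V] (m : V → V → ℕ) {A : Finset V} (s : V → Bool)
    (v : V) {w : V} (hw : w ∈ A) :
    crossCount m A s v = (if s w = s v then 0 else m v w) + crossCount m (A.erase w) s v :=
  (Finset.add_sum_erase A (fun u => if s u = s v then 0 else m v u) hw).symm

/-- A multigraph has a two-colouring in which at least half of the edges at each vertex have ends
of different colours. -/
lemma exists_forall_sum_erase_le_two_mul_crossCount [Finite V] [DecidableEq V] (m : V → V → ℕ)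
    (hm : ∀ x y, m x y = m y x) (A : Finset V) :
    ∃ s : V → Bool, ∀ v ∈ A, ∑ u ∈ A.erase v, m v u ≤ 2 * crossCount m A s v := by
  obtain ⟨s, hs⟩ := Finite.exists_max fun s : V → Bool => ∑ v ∈ A, crossCount m A s v
  refine ⟨s, fun v hv => ?_⟩
  have split : ∀ r : V → Bool, ∑ x ∈ A, crossCount m A r x =
      ∑ x ∈ A.erase v, crossCount m (A.erase v) r x + 2 * crossCount m (A.erase v) r v := by
    intro r
    rw [← Finset.add_sum_erase A _ hv, Finset.sum_congr rfl fun x _ =>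
      crossCount_eq_add_erase m r x hv, Finset.sum_add_distrib, crossCount_eq_add_erase m r v hv]
    have : ∑ x ∈ A.erase v, (if r v = r x then 0 else m x v) =
        crossCount m (A.erase v) r v :=
      Finset.sum_congr rfl fun x _ => by rw [hm x v]; simp only [eq_comm]
    rw [this]
    simp
    ring
  have flip := hs (Function.update s v (!s v))
  simp only [split] at flip
  have inner : ∑ x ∈ A.erase v, crossCount m (A.erase v) (Function.update s v (!s v)) x =
      ∑ x ∈ A.erase v, crossCount m (A.erase v) s x := by
    refine Finset.sum_congr rfl fun x hx => crossCount_congr hx (fun _ _ => rfl) fun u hu => ?_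
    simp [Finset.ne_of_mem_erase hu]
  have total : crossCount m (A.erase v) (Function.update s v (!s v)) v +
      crossCount m (A.erase v) s v = ∑ u ∈ A.erase v, m v u := by
    rw [crossCount, crossCount, ← Finset.sum_add_distrib]
    refine Finset.sum_congr rfl fun u hu => ?_
    rw [Function.update_of_ne (Finset.ne_of_mem_erase hu), Function.update_self]
    cases s u <;> cases s v <;> simp
  have hself := crossCount_eq_add_erase m s v hv
  simp only [if_true] at hself
  omega

/-- No union `X` of components of the multigraph `m` on `A` has total weight `1` under `t`. -/
def NoUnitComponent (m : V → V → ℕ) (t : V → ℕ) (A : Finset V) : Prop :=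
  ∀ X ⊆ A, (∀ x ∈ X, ∀ y ∈ A, y ∉ X → m x y = 0) → ∑ x ∈ X, t x ≠ 1

/-- Let `m` be a multigraph on `A` whose vertices `v` carry `t v` pendant half-edges. If no component
has exactly one half-edge, then `A` has a two-colouring in which no vertex has exactly one edge
that is a half-edge or leads to the other colour. -/
theorem exists_coloring_ne_one [Finite V] [DecidableEq V] (A : Finset V) :
    ∀ (m : V → V → ℕ) (t : V → ℕ), (∀ x y, m x y = m y x) → NoUnitComponent m t A →
      ∃ s : V → Bool, ∀ v ∈ A, t v + crossCount m A s v ≠ 1 := by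
  induction A using Finset.strongInduction with
  | H A ih =>
  intro m t hm hA
  by_cases hdeg : ∀ v ∈ A, 3 ≤ t v + ∑ u ∈ A.erase v, m v u
  · obtain ⟨s, hs⟩ := exists_forall_sum_erase_le_two_mul_crossCount m hm A
    refine ⟨s, fun v hv => ?_⟩
    have h1 := hs v hv
    have h2 := hdeg v hv
    omega
  push Not at hdeg
  obtain ⟨v, hv, hlt⟩ := hdeg
  have hvB : v ∉ A.erase v := Finset.notMem_erase v A
  have hBA : A.erase v ⊂ A := Finset.erase_ssubset hv
  by_cases hnone : ∀ u ∈ A.erase v, m v u = 0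
  · -- `v` is isolated.
    obtain ⟨s, hs⟩ := ih _ hBA m t hm fun X hX hc => hA X (hX.trans hBA.1) fun x hx y hy hyX => by
      rcases eq_or_ne y v with rfl | hyv
      · rw [hm]; exact hnone x (hX hx)
      · exact hc x hx y (Finset.mem_erase.2 ⟨hyv, hy⟩) hyX
    refine ⟨s, fun x hx => ?_⟩
    rw [crossCount_eq_add_erase m s x hv]
    rcases eq_or_ne x v with rfl | hxv
    · have h0 : crossCount m (A.erase x) s x = 0 :=
        Finset.sum_eq_zero fun u hu => by simp [hnone u hu]
      have := hA {x} (by simpa using hv) fun y hy z hz hzy => by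
        obtain rfl := Finset.mem_singleton.1 hy
        exact hnone z (Finset.mem_erase.2 ⟨by simpa using hzy, hz⟩)
      simpa [h0] using this
    · have hxB := Finset.mem_erase.2 ⟨hxv, hx⟩
      have := hs x hxB
      rw [hm x v, hnone x hxB]
      simpa using this
  push Not at hnone
  obtain ⟨u, hu, hvu⟩ := hnone
  have huv : u ≠ v := Finset.ne_of_mem_erase hu
  have hsum := Finset.add_sum_erase (A.erase v) (fun y => m v y) hu
  by_cases hone : ∀ y ∈ (A.erase v).erase u, m v y = 0
  · -- `u` is the only neighbour of `v`.
    have hother : ∀ y ∈ A, y ≠ v → y ≠ u → m v y = 0 := fun y hy h1 h2 =>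
      hone y (by simp [hy, h1, h2])
    rw [Finset.sum_eq_zero hone] at hsum
    have ht : t v = 0 ∨ t v = 1 ∧ m v u = 1 := by omega
    have closed : ∀ X ⊆ A.erase v, (∀ x ∈ X, ∀ y ∈ A.erase v, y ∉ X → m x y = 0) →
        ∑ x ∈ X, (t x + if x = u then t v else 0) ≠ 1 := by
      intro X hX hc
      by_cases huX : u ∈ X
      · have := hA (insert v X) (Finset.insert_subset hv (hX.trans hBA.1)) fun x hx y hy hyX => by
          simp only [Finset.mem_insert, not_or] at hx hyX
          rcases hx with rfl | hx
          · exact hother y hy hyX.1 fun h => hyX.2 (h ▸ huX)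
          · exact hc x hx y (Finset.mem_erase.2 ⟨hyX.1, hy⟩) hyX.2
        rw [Finset.sum_insert fun h => hvB (hX h)] at this
        rw [Finset.sum_add_distrib, Finset.sum_ite_eq' X u, if_pos huX]
        omega
      · have := hA X (hX.trans hBA.1) fun x hx y hy hyX => by
          rcases eq_or_ne y v with rfl | hyv
          · rw [hm]
            exact hother x (hBA.1 (hX hx)) (Finset.ne_of_mem_erase (hX hx))
              fun h => huX (h ▸ hx)
          · exact hc x hx y (Finset.mem_erase.2 ⟨hyv, hy⟩) hyX
        rw [Finset.sum_add_distrib, Finset.sum_ite_eq' X u, if_neg huX]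
        omega
    obtain ⟨s, hs⟩ := ih _ hBA m (fun x => t x + if x = u then t v else 0) hm closed
    -- The colour of `v` agrees with that of `u` unless `v` has a half-edge.
    set s' : V → Bool := Function.update s v (s u ^^ decide (t v = 1)) with hs'
    have hsv : s' v = (s u ^^ decide (t v = 1)) := by simp [hs']
    have hsne : ∀ y, y ≠ v → s' y = s y := fun y hy => by simp [hs', hy]
    refine ⟨s', fun x hx => ?_⟩
    rw [crossCount_eq_add_erase m s' x hv]
    rcases eq_or_ne x v with rfl | hxv
    · rw [crossCount_eq_add_erase m s' x hu]
      have h0 : crossCount m ((A.erase x).erase u) s' x = 0 :=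
        Finset.sum_eq_zero fun y hy => by simp [hone y hy]
      rw [h0, hsv, hsne u huv]
      rcases ht with h | ⟨h, h'⟩
      · simp [h]
      · simp [h, h']
    · have hxB := Finset.mem_erase.2 ⟨hxv, hx⟩
      have h1 := hs x hxB
      rw [crossCount_congr (m' := m) (s' := s) hxB (fun _ _ => rfl)
        fun y hy => hsne y (Finset.ne_of_mem_erase hy), hsv, hsne x hxv, hm x v]
      rcases eq_or_ne x u with rfl | hxu
      · rcases ht with h | ⟨h, h'⟩
        · simpa [h] using h1
        · simpa [h, h', add_assoc] using h1
      · simpa [hxu, hother x hx hxv hxu] using h1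
  -- `v` has exactly two neighbours `u` and `w`, which are merged.
  push Not at hone
  obtain ⟨w, hw, hvw⟩ := hone
  have hwu : w ≠ u := Finset.ne_of_mem_erase hw
  have hwB : w ∈ A.erase v := Finset.mem_of_mem_erase hw
  have hwv : w ≠ v := Finset.ne_of_mem_erase hwB
  have hsum' := Finset.add_sum_erase ((A.erase v).erase u) (fun y => m v y) hw
  have htv : t v = 0 := by omega
  have hvu1 : m v u = 1 := by omega
  have hvw1 : m v w = 1 := by omega
  have hother : ∀ y ∈ A, y ≠ v → y ≠ u → y ≠ w → m v y = 0 := fun y hy h1 h2 h3 =>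
    Finset.sum_eq_zero_iff.1 (by omega : ∑ y ∈ ((A.erase v).erase u).erase w, m v y = 0) y
      (by simp [hy, h1, h2, h3])
  set C := (A.erase v).erase w with hC
  have hCB : C ⊂ A := (Finset.erase_subset _ _).trans_ssubset hBA
  have huC : u ∈ C := by simp [hC, huv, hwu.symm, hBA.1 hu]
  have memC : ∀ y, y ∈ C ↔ y ≠ w ∧ y ≠ v ∧ y ∈ A := fun y => by simp [hC]
  let m' : V → V → ℕ := fun x y =>
    m x y + (if x = u then m w y else 0) + (if y = u then m x w else 0)
  let t' : V → ℕ := fun x => t x + if x = u then t w else 0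
  have hm' : ∀ x y, m' x y = m' y x := fun x y => by
    simp only [m', hm x y, hm w y, hm x w]; omega
  have closed : NoUnitComponent m' t' C := by
    intro X hX hc
    have hle : ∀ x ∈ X, ∀ y ∈ C, y ∉ X → m x y = 0 := fun x hx y hy hyX => by
      have := hc x hx y hy hyX
      simp only [m'] at this
      omega
    simp only [t', Finset.sum_add_distrib, Finset.sum_ite_eq']
    have hvX : v ∉ X := fun h => ((memC v).1 (hX h)).2.1 rfl
    have hwX : w ∉ X := fun h => ((memC w).1 (hX h)).1 rfl
    by_cases huX : u ∈ X
    · have := hA (insert v (insert w X))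
        (Finset.insert_subset hv (Finset.insert_subset (hBA.1 hwB) (hX.trans hCB.1)))
        fun x hx y hy hyX => by
          simp only [Finset.mem_insert, not_or] at hx hyX
          have hyC : y ∈ C := (memC y).2 ⟨hyX.2.1, hyX.1, hy⟩
          rcases hx with rfl | rfl | hx
          · exact hother y hy hyX.1 (fun h => hyX.2.2 (h ▸ huX)) hyX.2.1
          · have := hc u huX y hyC hyX.2.2
            simp only [m', if_true] at this
            omega
          · exact hle x hx y hyC hyX.2.2
      rw [Finset.sum_insert (by simp [hvX, hwv.symm]), Finset.sum_insert hwX] at this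
      rw [if_pos huX]
      omega
    · rw [if_neg huX, add_zero]
      refine hA X (hX.trans hCB.1) fun x hx y hy hyX => ?_
      have hxu : x ≠ u := fun h => huX (h ▸ hx)
      have hxC := (memC x).1 (hX hx)
      rcases eq_or_ne y v with rfl | hyv
      · rw [hm]
        exact hother x hxC.2.2 hxC.2.1 hxu hxC.1
      rcases eq_or_ne y w with rfl | hyw
      · have := hc x hx u huC huX
        simp only [m', if_true] at this
        omega
      · exact hle x hx y ((memC y).2 ⟨hyw, hyv, hy⟩) hyX
  obtain ⟨s, hs⟩ := ih C hCB m' t' hm' closed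
  -- With `w` coloured like `u`, the count at `u` splits into the contributions of `u` and `w`.
  let cw : ℕ := t w + ∑ y ∈ C, if s y = s u then 0 else m w y
  let cu : ℕ := t u + ∑ y ∈ C, if s y = s u then 0 else m u y
  have hcuw : cu + cw ≠ 1 := by
    have h := hs u huC
    have : crossCount m' C s u = (∑ y ∈ C, if s y = s u then 0 else m u y) +
        ∑ y ∈ C, if s y = s u then 0 else m w y := by
      rw [crossCount, ← Finset.sum_add_distrib]
      refine Finset.sum_congr rfl fun y _ => ?_
      split_ifs with hy
      · rfl
      · have : y ≠ u := fun h => hy (h ▸ rfl)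
        simp [m', this]
    simp only [t', if_true] at h
    simp only [cu, cw]
    omega
  set s' : V → Bool := Function.update (Function.update s w (s u)) v
    (s u ^^ decide (1 ≤ cu ∧ 1 ≤ cw)) with hs'
  have hsv : s' v = (s u ^^ decide (1 ≤ cu ∧ 1 ≤ cw)) := by simp [hs']
  have hsw : s' w = s u := by simp [hs', hwv]
  have hsC : ∀ y ∈ C, s' y = s y := fun y hy => by
    have := (memC y).1 hy
    simp [hs', this.1, this.2.1]
  have expand : ∀ x, crossCount m A s' x = (if s' v = s' x then 0 else m x v) +
      ((if s' w = s' x then 0 else m x w) + crossCount m C s' x) := fun x => by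
    rw [crossCount_eq_add_erase m s' x hv, crossCount_eq_add_erase m s' x hwB]
  refine ⟨s', fun x hx => ?_⟩
  rw [expand]
  have hmuv : m u v = 1 := by rw [hm, hvu1]
  have hmwv : m w v = 1 := by rw [hm, hvw1]
  have hflip : s' v = s u ↔ ¬(1 ≤ cu ∧ 1 ≤ cw) := by
    rw [hsv]
    by_cases h : 1 ≤ cu ∧ 1 ≤ cw <;> simp [h]
  rcases eq_or_ne x v with rfl | hxv
  · rw [crossCount_eq_add_erase m s' x huC, hsC u huC, hsw]
    have h0 : crossCount m (C.erase u) s' x = 0 := Finset.sum_eq_zero fun y hy => by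
      have hyC := (memC y).1 (Finset.mem_of_mem_erase hy)
      simp [hother y hyC.2.2 hyC.2.1 (Finset.ne_of_mem_erase hy) hyC.1]
    rw [h0, hvu1, hvw1, htv, if_pos (rfl : s' x = s' x)]
    split_ifs <;> simp
  rcases eq_or_ne x w with rfl | hxw
  · have h1 : crossCount m C s' x = ∑ y ∈ C, if s y = s u then 0 else m x y :=
      Finset.sum_congr rfl fun y hy => by rw [hsC y hy, hsw]
    rw [h1, hmwv, if_pos rfl, hsw]
    by_cases h : 1 ≤ cu ∧ 1 ≤ cw
    · rw [if_neg (by rw [hflip, not_not]; exact h)]; simp only [cw] at *; omega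
    · rw [if_pos (hflip.2 h)]; simp only [cw] at *; omega
  have hxC : x ∈ C := (memC x).2 ⟨hxw, hxv, hx⟩
  rw [crossCount_congr (m' := m) (s' := s) hxC (fun _ _ => rfl) hsC, hsC x hxC, hsw]
  rcases eq_or_ne x u with rfl | hxu
  · have h1 : crossCount m C s x = ∑ y ∈ C, if s y = s x then 0 else m x y := rfl
    rw [h1, hmuv, if_pos (rfl : s x = s x)]
    by_cases h : 1 ≤ cu ∧ 1 ≤ cw
    · rw [if_neg (by rw [hflip, not_not]; exact h)]; simp only [cu] at *; omega
    · rw [if_pos (hflip.2 h)]; simp only [cu] at *; omega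
  · have h1 := hs x hxC
    have h2 : crossCount m' C s x = (if s u = s x then 0 else m x w) + crossCount m C s x := by
      rw [crossCount_eq_add_erase m' s x huC, crossCount_eq_add_erase m s x huC]
      have : crossCount m' (C.erase u) s x = crossCount m (C.erase u) s x :=
        Finset.sum_congr rfl fun y hy => by simp [m', hxu, Finset.ne_of_mem_erase hy]
      rw [this]
      simp only [m', hxu, if_false, if_true]
      split_ifs <;> omega
    rw [hm x v, hother x hx hxv hxu hxw]
    simp only [t', hxu, if_false, add_zero] at h1
    simpa [h2] using h1

open scoped Classical in
/-- A fort: a nonempty set in which no outside vertex has exactly one neighbour. -/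
def IsFort [Fintype V] (G : SimpleGraph V) (W : Finset V) : Prop :=
  W.Nonempty ∧ ∀ v ∉ W, {u ∈ W | G.Adj v u}.card ≠ 1

open scoped Classical in
lemma IsFort.isFailed_compl [Fintype V] {G : SimpleGraph V} {W : Finset V} (hW : IsFort G W) :
    IsFailed G ↑(Wᶜ) := by
  obtain ⟨w, hw⟩ := hW.1
  have avoid : ∀ v, ZFDerived G ↑(Wᶜ) v → v ∉ W := by
    intro v hv
    induction hv with
    | init h => simpa using h
    | @force v x _ hvx _ hv hother =>
      intro hx
      refine hW.2 v hv (Finset.card_eq_one.2 ⟨x, Finset.ext fun y => ?_⟩)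
      simp only [Finset.mem_filter, Finset.mem_singleton]
      refine ⟨fun hy => ?_, fun h => h ▸ ⟨hx, hvx⟩⟩
      by_contra hyx
      exact hother y hy.2 hyx hy.1
  exact fun h => avoid w (h.symm ▸ Set.mem_univ w : w ∈ ZFDerivedSet G ↑(Wᶜ)) hw

lemma IsFort.card_sub_card_le_failedZF [Fintype V] {G : SimpleGraph V} {W : Finset V}
    (hW : IsFort G W) : Fintype.card V - W.card ≤ failedZF G := by
  classical
  refine le_csSup ⟨Fintype.card V, ?_⟩ ⟨Wᶜ, hW.isFailed_compl, Finset.card_compl W⟩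
  rintro k ⟨S, -, rfl⟩
  exact S.card_le_univ

open scoped Classical in
/-- The two ends `a`, `b` of a diameter satisfy the hypothesis of the colouring theorem. -/
lemma noUnitComponent_of_dist_le [Fintype V] {G : SimpleGraph V} (hG : G.Connected) {a b : V}
    (hmax : ∀ x y, G.dist x y ≤ G.dist a b) :
    NoUnitComponent (fun x y => if G.Adj x y then 1 else 0)
      (fun v => {u ∈ ({a, b} : Finset V) | G.Adj v u}.card) ({a, b} : Finset V)ᶜ := by
  intro X hX hc hsum
  have key : ∀ c d, G.dist c d = G.dist a b → ({a, b} : Finset V) = {c, d} →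
      (∃ x ∈ X, G.Adj x c) → ∃ x ∈ X, G.Adj x d := by
    rintro c d hcd hset ⟨x, hx, hxc⟩
    by_contra! hno
    obtain ⟨p, hp⟩ := hG.exists_walk_length_eq_dist x d
    have hdX : d ∉ X := fun h => by
      have := hX h
      simp [hset] at this
    obtain ⟨e, he, he1, he2⟩ := p.exists_boundary_dart (X : Set V) hx hdX
    have heT : e.snd ∈ ({c, d} : Finset V) := by
      by_contra h
      have := hc e.fst he1 e.snd (by rwa [hset, Finset.mem_compl]) he2
      simp [e.adj] at this
    have hec : e.snd = c := by
      rcases Finset.mem_insert.1 heT with h | h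
      · exact h
      · exact absurd (Finset.mem_singleton.1 h ▸ e.adj) (hno _ he1)
    have hcp : c ∈ p.support := hec ▸ p.dart_snd_mem_support_of_mem_darts he
    have hlen := congrArg Walk.length (p.take_spec hcp)
    rw [Walk.length_append] at hlen
    have h1 : G.dist x c ≤ (p.takeUntil c hcp).length := dist_le _
    have h2 : G.dist c d ≤ (p.dropUntil c hcp).length := dist_le _
    have h3 : G.dist x c = 1 := dist_eq_one_iff_adj.2 hxc
    have h4 := hmax x d
    omega
  have hne : a ≠ b := by
    rintro rfl
    obtain ⟨x, hx, hx0⟩ := Finset.exists_ne_zero_of_sum_ne_zero (by rw [hsum]; simp)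
    obtain ⟨y, hy⟩ := Finset.card_pos.1 (Nat.pos_of_ne_zero hx0)
    have := hmax x y
    rw [dist_self, dist_eq_one_iff_adj.2 (Finset.mem_filter.1 hy).2] at this
    omega
  have hcount : ∀ v, {u ∈ ({a, b} : Finset V) | G.Adj v u}.card =
      (if G.Adj v a then 1 else 0) + if G.Adj v b then 1 else 0 := fun v => by
    rw [Finset.card_filter, Finset.sum_pair hne]
  simp only [hcount, Finset.sum_add_distrib, ← Finset.card_filter] at hsum
  have pos : ∀ c, 0 < {x ∈ X | G.Adj x c}.card ↔ ∃ x ∈ X, G.Adj x c := fun c => by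
    simp [Finset.card_pos, Finset.filter_nonempty_iff]
  have hab := key a b rfl rfl
  have hba := key b a dist_comm (Finset.pair_comm a b)
  rw [← pos, ← pos] at hab hba
  omega

/-- A connected graph has a fort of size at most `n / 2 + 1`: the two colour classes, each enlarged
by the ends of a diameter, are forts. -/
lemma exists_isFort_card_le [Fintype V] {G : SimpleGraph V} (hG : G.Connected) :
    ∃ W, IsFort G W ∧ 2 * W.card ≤ Fintype.card V + 2 := by
  classical
  have := hG.nonempty
  obtain ⟨⟨a, b⟩, hmax⟩ := Finite.exists_max fun p : V × V => G.dist p.1 p.2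
  obtain ⟨s, hs⟩ := exists_coloring_ne_one _ _ _ (by simp [G.adj_comm])
    (noUnitComponent_of_dist_le hG fun x y => hmax (x, y))
  set T : Finset V := {a, b}
  let W : Bool → Finset V := fun i => {v | v ∈ T ∨ s v = i}
  have hfort : ∀ i, IsFort G (W i) := fun i => by
    refine ⟨⟨a, by simp [W, T]⟩, fun v hv => ?_⟩
    simp only [W, Finset.mem_filter, Finset.mem_univ, true_and, not_or] at hv
    have := hs v (Finset.mem_compl.2 hv.1)
    convert this using 1
    have hsplit : {u ∈ W i | G.Adj v u} =
        {u ∈ T | G.Adj v u} ∪ {u ∈ Tᶜ | s u ≠ s v ∧ G.Adj v u} := by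
      ext u
      have : s u = i ↔ s u ≠ s v := by
        have := hv.2
        revert this
        cases s u <;> cases s v <;> cases i <;> simp
      simp only [W, Finset.mem_filter, Finset.mem_union, Finset.mem_univ, true_and,
        Finset.mem_compl, this]
      tauto
    rw [hsplit, Finset.card_union_of_disjoint
      (Finset.disjoint_filter_filter disjoint_compl_right), crossCount]
    congr 1
    rw [Finset.card_filter]
    refine Finset.sum_congr rfl fun u _ => ?_
    by_cases h : s u = s v <;> simp [h]
  have hcard : (W true).card + (W false).card ≤ Fintype.card V + 2 := by
    rw [← Finset.card_union_add_card_inter]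
    refine add_le_add (Finset.card_le_univ _) ?_
    refine (Finset.card_le_card (t := T) fun v hv => ?_).trans Finset.card_le_two
    simp only [W, Finset.mem_inter, Finset.mem_filter, Finset.mem_univ, true_and] at hv
    by_contra h
    simp_all
  rcases le_total (W true).card (W false).card with h | h
  · exact ⟨W true, hfort _, by omega⟩
  · exact ⟨W false, hfort _, by omega⟩

lemma exists_isFort_card_le_of_not_preconnected [Fintype V] {G : SimpleGraph V}
    (hG : ¬G.Preconnected) : ∃ W, IsFort G W ∧ 2 * W.card ≤ Fintype.card V := by
  classical
  simp only [Preconnected, not_forall] at hG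
  obtain ⟨x, y, hxy⟩ := hG
  have closed : ∀ W : Finset V, W.Nonempty → (∀ v ∉ W, ∀ u ∈ W, ¬G.Adj v u) → IsFort G W :=
    fun W hW h => ⟨hW, fun v hv => by simp [Finset.filter_false_of_mem (h v hv)]⟩
  let W : Finset V := {v | G.Reachable x v}
  have h1 : IsFort G W := closed W ⟨x, by simp [W]⟩ fun v hv u hu huv => by
    simp only [W, Finset.mem_filter, Finset.mem_univ, true_and] at hv hu
    exact hv (hu.trans huv.symm.reachable)
  have h2 : IsFort G Wᶜ := closed _ ⟨y, by simpa [W] using hxy⟩ fun v hv u hu huv => by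
    simp only [W, Finset.mem_compl, Finset.mem_filter, Finset.mem_univ, true_and, not_not] at hv hu
    exact hu (hv.trans huv.reachable)
  have hcard := Finset.card_add_card_compl W
  rcases le_total W.card Wᶜ.card with h | h
  · exact ⟨W, h1, by omega⟩
  · exact ⟨Wᶜ, h2, by omega⟩

theorem failedZF_ge_floor {V : Type*} [Fintype V] (G : SimpleGraph V) :
    (Fintype.card V - 1) / 2 ≤ failedZF G := by
  rcases isEmpty_or_nonempty V with _ | _
  · simp
  obtain ⟨W, hW, hcard⟩ : ∃ W, IsFort G W ∧ 2 * W.card ≤ Fintype.card V + 2 := by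
    by_cases hG : G.Preconnected
    · exact exists_isFort_card_le ⟨hG⟩
    · obtain ⟨W, hW, hcard⟩ := exists_isFort_card_le_of_not_preconnected hG
      exact ⟨W, hW, by omega⟩
  have := hW.card_sub_card_le_failedZF
  omega
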